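/- Let γ ∈ [0,1) and let X be a càdlàg path with no positive jumps and X_0 ≤ 0. Let V⁺ and K⁺ be càdlàg paths with V⁺_t ≥ 0 for all t and K⁺ increasing. Then (V⁺, K⁺) is a tax-reflection pair for (X, δ ≡ γ, x̄ = 0) if and only if, setting Y_t = X_t − γ·max(0, sup_{0≤s≤t}(X_s + K⁺_s)), one has K⁺_t = Ψ_t(Y) and V⁺_t = Φ_t(Y) for all t ≥ 0. -/

import Mathlib

open MeasureTheory Set Filter Function

noncomputable section

/-- Running supremum of a path over `[0, t]`. -/
def runSSup (Z : ℝ → ℝ) (t : ℝ) : ℝ := sSup (Z '' Set.Icc 0 t)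

/-- Running supremum of a path with initial maximum level `xbar`. -/
def runSup (xbar : ℝ) (Z : ℝ → ℝ) (t : ℝ) : ℝ := max xbar (runSSup Z t)

/-- Skorokhod regulator at 0. -/
def Psi (Y : ℝ → ℝ) (t : ℝ) : ℝ := max 0 (-(sInf (Y '' Set.Icc 0 t)))

/-- Reflection of a path at 0 from below. -/
def Phi (Y : ℝ → ℝ) (t : ℝ) : ℝ := Y t + Psi Y t

/-- A path, viewed on `[0,∞)`, is càdlàg: right-continuous at every `t ≥ 0` and
with left limits at every `t > 0`. -/
def Cadlag (Z : ℝ → ℝ) : Prop :=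
  (∀ t : ℝ, 0 ≤ t → ContinuousWithinAt Z (Set.Ici t) t) ∧
  (∀ t : ℝ, 0 < t → ∃ l : ℝ, Filter.Tendsto Z (nhdsWithin t (Set.Iio t)) (nhds l))

/-- A càdlàg path has no positive jumps if `ΔZ_t = Z_t - Z_{t-} ≤ 0` for all `t > 0`. -/
def NoPosJumps (Z : ℝ → ℝ) : Prop :=
  ∀ t : ℝ, 0 < t → Z t ≤ Function.leftLim Z t

/-- Lebesgue–Stieltjes measure of an increasing right-continuous path on `[0,∞)`,
without the atom at `0`. -/
def lsMeasureAux (f : ℝ → ℝ) : Measure ℝ := by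
  classical
  exact if h : Monotone (fun t => f (max t 0)) ∧
      ∀ x : ℝ, ContinuousWithinAt (fun t => f (max t 0)) (Set.Ici x) x then
    StieltjesFunction.measure ⟨fun t => f (max t 0), h.1, h.2⟩
  else 0

/-- Lebesgue–Stieltjes measure of an increasing right-continuous path on `[0,∞)`,
with an atom of mass `f 0` at `0`. -/
def lsMeasure (f : ℝ → ℝ) : Measure ℝ :=
  lsMeasureAux f + (ENNReal.ofReal (f 0)) • Measure.dirac 0

/-- `(V, K)` is a tax-reflection pair for `(X, δ, xbar)`. -/
def IsTaxReflectionPair (δ : ℝ → ℝ) (X : ℝ → ℝ) (xbar : ℝ) (V K : ℝ → ℝ) : Prop :=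
  Cadlag V ∧ Cadlag K ∧
  (∀ t : ℝ, 0 ≤ t → 0 ≤ V t) ∧
  MonotoneOn K (Set.Ici 0) ∧
  (∀ t : ℝ, 0 ≤ t →
    V t = X t + K t -
      ∫ s in Set.Ioc (0:ℝ) t, δ (V s)
        ∂(lsMeasure (runSup xbar (fun s => X s + K s)))) ∧
  lsMeasure K {t : ℝ | 0 ≤ t ∧ 0 < V t} = 0

/-- A solution of the ODE `y' = 1 - δ(y)`, `y(0) = y₀`, on `[0,∞)`. -/
def IsFlow (δ : ℝ → ℝ) (y₀ : ℝ) (y : ℝ → ℝ) : Prop :=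
  ContinuousOn y (Set.Ici 0) ∧
  ∀ t : ℝ, 0 ≤ t → y t = y₀ + ∫ s in (0:ℝ)..t, (1 - δ (y s))

/-- `δ` admits a unique flow: for every `y₀ ≥ 0` the ODE `y' = 1 - δ(y)`, `y(0) = y₀`
has exactly one continuous solution on `[0,∞)`. -/
def AdmitsUniqueFlow (δ : ℝ → ℝ) : Prop :=
  ∀ y₀ : ℝ, 0 ≤ y₀ →
    (∃ y : ℝ → ℝ, IsFlow δ y₀ y) ∧
    ∀ y z : ℝ → ℝ, IsFlow δ y₀ y → IsFlow δ y₀ z → ∀ t : ℝ, 0 ≤ t → y t = z t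

theorem lsMeasureAux_eq {f : ℝ → ℝ} (hf : MonotoneOn f (Set.Ici 0))
    (hc : ∀ t : ℝ, 0 ≤ t → ContinuousWithinAt f (Set.Ici t) t) :
    ∃ F : StieltjesFunction ℝ, (∀ t, F t = f (max t 0)) ∧ lsMeasureAux f = F.measure := by
  have h : Monotone (fun t => f (max t 0)) ∧
      ∀ x : ℝ, ContinuousWithinAt (fun t => f (max t 0)) (Set.Ici x) x := by
    constructor
    · intro a b hab
      exact hf (mem_Ici.2 (le_max_right a 0)) (mem_Ici.2 (le_max_right b 0))
        (max_le_max_right 0 hab)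
    · intro x
      refine ContinuousWithinAt.comp (g := f) (f := fun t => max t 0) (t := Set.Ici (max x 0))
        (hc _ (le_max_right _ _)) (by fun_prop) ?_
      intro y hy
      exact max_le_max_right 0 (mem_Ici.1 hy)
  refine ⟨⟨fun t => f (max t 0), h.1, h.2⟩, fun t => rfl, ?_⟩
  rw [lsMeasureAux, dif_pos h]

theorem lsMeasure_Ioc {f : ℝ → ℝ} (hf : MonotoneOn f (Set.Ici 0))
    (hc : ∀ t : ℝ, 0 ≤ t → ContinuousWithinAt f (Set.Ici t) t) {t : ℝ} (ht : 0 ≤ t) :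
    lsMeasure f (Set.Ioc 0 t) = ENNReal.ofReal (f t - f 0) := by
  obtain ⟨F, hF, hm⟩ := lsMeasureAux_eq hf hc
  simp [lsMeasure, hm, hF, ht]

/-- A path with one-sided limits is bounded on compact intervals. -/
theorem Cadlag.isBounded_image {Z : ℝ → ℝ} (hZ : Cadlag Z) (t : ℝ) :
    Bornology.IsBounded (Z '' Set.Icc 0 t) := by
  refine isCompact_Icc.induction_on (p := fun s => Bornology.IsBounded (Z '' s)) (by simp)
    (fun s t hst ht => ht.subset (Set.image_mono hst))
    (fun s t hs ht => by rw [Set.image_union]; exact hs.union ht) ?_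
  intro x hx
  have bdd : ∀ {l : Filter ℝ} {a : ℝ}, Tendsto Z l (nhds a) →
      ∃ s ∈ l, Bornology.IsBounded (Z '' s) := by
    intro l a h
    exact ⟨_, h (Metric.ball_mem_nhds a one_pos),
      Metric.isBounded_ball.subset (Set.image_preimage_subset _ _)⟩
  obtain ⟨s, hs, hsb⟩ := bdd (hZ.1 x hx.1)
  rcases hx.1.eq_or_lt with h0 | h0
  · refine ⟨s, nhdsWithin_mono x ?_ hs, hsb⟩
    rw [← h0]; exact Set.Icc_subset_Ici_self
  · obtain ⟨l, hl⟩ := hZ.2 x h0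
    obtain ⟨r, hr, hrb⟩ := bdd hl
    refine ⟨s ∪ r, mem_nhdsWithin_of_mem_nhds ?_, by rw [Set.image_union]; exact hsb.union hrb⟩
    rw [← nhdsLT_sup_nhdsGE]
    exact ⟨mem_of_superset hr subset_union_right, mem_of_superset hs subset_union_left⟩

theorem Cadlag.add {Z W : ℝ → ℝ} (hZ : Cadlag Z) (hW : Cadlag W) :
    Cadlag (fun t => Z t + W t) := by
  refine ⟨fun t ht => (hZ.1 t ht).add (hW.1 t ht), fun t ht => ?_⟩
  obtain ⟨a, ha⟩ := hZ.2 t ht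
  obtain ⟨b, hb⟩ := hW.2 t ht
  exact ⟨a + b, ha.add hb⟩

theorem runSup_le_iff {Z : ℝ → ℝ} (hZ : Cadlag Z) {a t c : ℝ} (ht : 0 ≤ t) :
    runSup a Z t ≤ c ↔ a ≤ c ∧ ∀ u ∈ Set.Icc 0 t, Z u ≤ c := by
  rw [runSup, runSSup, max_le_iff, csSup_le_iff (hZ.isBounded_image t).bddAbove
    ((Set.nonempty_Icc.2 ht).image _), Set.forall_mem_image]

theorem runSup_zero (a : ℝ) (Z : ℝ → ℝ) : runSup a Z 0 = max a (Z 0) := by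
  simp [runSup, runSSup]

theorem runSup_monotoneOn {Z : ℝ → ℝ} (hZ : Cadlag Z) (a : ℝ) :
    MonotoneOn (runSup a Z) (Set.Ici 0) := by
  intro s hs t ht hst
  have h := (runSup_le_iff hZ (a := a) (Set.mem_Ici.1 ht)).1 le_rfl
  exact (runSup_le_iff hZ hs).2 ⟨h.1, fun u hu => h.2 u ⟨hu.1, hu.2.trans hst⟩⟩

theorem runSup_rightContinuous {Z : ℝ → ℝ} (hZ : Cadlag Z) (a t : ℝ) (ht : 0 ≤ t) :
    ContinuousWithinAt (runSup a Z) (Set.Ici t) t := by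
  have hmax := (runSup_le_iff hZ (a := a) ht).1 le_rfl
  refine tendsto_order.2 ⟨fun c hc => ?_, fun c hc => ?_⟩
  · filter_upwards [self_mem_nhdsWithin] with u hu
    exact hc.trans_le (runSup_monotoneOn hZ a ht (ht.trans hu) hu)
  · obtain ⟨d, hd, hdc⟩ := exists_between hc
    have hev : ∀ᶠ u in nhdsWithin t (Set.Ici t), Z u < d :=
      (hZ.1 t ht).eventually_lt_const ((hmax.2 t ⟨ht, le_rfl⟩).trans_lt hd)
    obtain ⟨r, hr, hrs⟩ := (mem_nhdsGE_iff_exists_Ico_subset).1 hev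
    filter_upwards [Ico_mem_nhdsGE hr] with u hu
    refine lt_of_le_of_lt ((runSup_le_iff hZ (ht.trans hu.1)).2
      ⟨hmax.1.trans hd.le, fun v hv => ?_⟩) hdc
    rcases le_total v t with h | h
    · exact (hmax.2 v ⟨hv.1, h⟩).trans hd.le
    · exact le_of_lt (hrs ⟨h, hv.2.trans_lt hu.2⟩)

theorem Psi_le_iff {Y : ℝ → ℝ} {t c : ℝ} (ht : 0 ≤ t) (hY : BddBelow (Y '' Set.Icc 0 t)) :
    Psi Y t ≤ c ↔ 0 ≤ c ∧ ∀ u ∈ Set.Icc 0 t, -Y u ≤ c := by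
  rw [Psi, max_le_iff, neg_le, le_csInf_iff hY ((Set.nonempty_Icc.2 ht).image _),
    Set.forall_mem_image]
  simp only [neg_le]

/-- A set is null if each of its points is the left endpoint of a null half-open interval. -/
theorem measure_eq_zero_of_forall_exists_Ico (μ : Measure ℝ) (N : Set ℝ)
    (h : ∀ s ∈ N, ∃ q > s, μ (Set.Ico s q) = 0) : μ N = 0 := by
  have hq : ∀ q : ℚ, μ {s | s < q ∧ μ (Set.Ico s q) = 0} = 0 := by
    intro q
    set A := {s : ℝ | s < q ∧ μ (Set.Ico s q) = 0}
    have hrat : μ (⋃ p : ℚ, ⋃ _ : (p : ℝ) ∈ A, Set.Ico (p : ℝ) q) = 0 :=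
      measure_iUnion_null fun p => measure_iUnion_null fun hp : (p : ℝ) ∈ A => hp.2
    by_cases hl : ∃ a, IsLeast A a
    · obtain ⟨a, ha⟩ := hl
      exact measure_mono_null (show A ⊆ Set.Ico a q from fun s hs => ⟨ha.2 hs, hs.1⟩) ha.1.2
    · refine measure_mono_null (fun s hs => ?_) hrat
      obtain ⟨r, hr, hrs⟩ : ∃ r ∈ A, r < s := by
        by_contra! hcon
        exact hl ⟨s, hs, hcon⟩
      obtain ⟨p, hrp, hps⟩ := exists_rat_btwn hrs
      simp only [Set.mem_iUnion]
      exact ⟨p, ⟨hps.trans hs.1, measure_mono_null (Set.Ico_subset_Ico_left hrp.le) hr.2⟩,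
        hps.le, hs.1⟩
  refine measure_mono_null (fun s hs => ?_) (measure_iUnion_null hq)
  obtain ⟨r, hsr, hr⟩ := h s hs
  obtain ⟨q, hsq, hqr⟩ := exists_rat_btwn hsr
  exact Set.mem_iUnion.2
    ⟨q, hsq, measure_mono_null (Set.Ico_subset_Ico_right hqr.le) hr⟩

/-- Minimality of the regulator: a nonnegative increasing `K` that keeps `Y + K` nonnegative and
grows only where `Y + K = 0` is the Skorokhod regulator of `Y`. -/
theorem eq_Psi_of_complementarity {Y V K : ℝ → ℝ}
    (hY : ∀ t, 0 ≤ t → BddBelow (Y '' Set.Icc 0 t))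
    (hKc : ∀ t : ℝ, 0 ≤ t → ContinuousWithinAt K (Set.Ici t) t)
    (hKmono : MonotoneOn K (Set.Ici 0)) (hK0 : 0 ≤ K 0)
    (hVpos : ∀ t : ℝ, 0 ≤ t → 0 ≤ V t) (hV : ∀ t, 0 ≤ t → V t = Y t + K t)
    (hnull : lsMeasure K {t : ℝ | 0 ≤ t ∧ 0 < V t} = 0) {t : ℝ} (ht : 0 ≤ t) :
    K t = Psi Y t := by
  obtain ⟨F, hF, hm⟩ := lsMeasureAux_eq hKmono hKc
  refine le_antisymm ?_ ?_
  swap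
  · refine (Psi_le_iff ht (hY t ht)).2 ⟨hK0.trans (hKmono self_mem_Ici ht ht), fun u hu => ?_⟩
    have h1 := hVpos u hu.1
    have h2 := hV u hu.1
    have h3 := hKmono hu.1 ht hu.2
    linarith
  by_contra! hlt
  obtain ⟨hm0, hmY⟩ := (Psi_le_iff ht (hY t ht)).1 le_rfl
  set m := Psi Y t
  set J := {s : ℝ | s ∈ Set.Icc 0 t ∧ m < K s}
  have htJ : t ∈ J := ⟨⟨ht, le_rfl⟩, hlt⟩
  have hJb : BddBelow J := ⟨0, fun s hs => hs.1.1⟩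
  have hJV : J ⊆ {t : ℝ | 0 ≤ t ∧ 0 < V t} := fun s hs => ⟨hs.1.1, by
    have := hmY s hs.1
    have := hV s hs.1.1
    have := hs.2
    linarith⟩
  set b := sInf J
  have hb0 : 0 ≤ b := le_csInf ⟨t, htJ⟩ fun s hs => hs.1.1
  have hbt : b ≤ t := csInf_le hJb htJ
  have hbJ : ∀ s, b < s → s ≤ t → s ∈ J := by
    intro s hbs hst
    obtain ⟨r, hr, hrs⟩ := exists_lt_of_csInf_lt ⟨t, htJ⟩ hbs
    exact ⟨⟨hb0.trans hbs.le, hst⟩,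
      hr.2.trans_le (hKmono hr.1.1 (hb0.trans hbs.le) hrs.le)⟩
  have hnull' := measure_mono_null hJV hnull
  rw [lsMeasure, Measure.add_apply, add_eq_zero, hm] at hnull'
  by_cases hbm : m < K b
  · have hb : b ∈ J := ⟨⟨hb0, hbt⟩, hbm⟩
    have hsub : {b} ⊆ J := Set.singleton_subset_iff.2 hb
    rcases hb0.eq_or_lt with h0 | h0
    · have := measure_mono_null hsub
        (show (ENNReal.ofReal (K 0) • Measure.dirac (0 : ℝ)) J = 0 from hnull'.2)
      rw [← h0] at this hbm
      simp only [Measure.smul_apply, smul_eq_mul, mul_eq_zero] at this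
      rcases this with h | h
      · exact absurd (ENNReal.ofReal_eq_zero.1 h) (not_le.2 (hm0.trans_lt hbm))
      · simp at h
    · have := measure_mono_null hsub hnull'.1
      rw [StieltjesFunction.measure_singleton, ENNReal.ofReal_eq_zero, hF, max_eq_left hb0] at this
      have hle : leftLim F b ≤ m := by
        refine le_of_tendsto (F.mono.tendsto_leftLim b) ?_
        filter_upwards [Ioo_mem_nhdsLT h0] with u hu
        rw [hF, max_eq_left hu.1.le]
        by_contra! hcon
        exact absurd (csInf_le hJb (⟨⟨hu.1.le, hu.2.le.trans hbt⟩, hcon⟩ : u ∈ J))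
          (not_le.2 hu.2)
      linarith
  · have := measure_mono_null (fun s (hs : s ∈ Set.Ioc b t) => hbJ s hs.1 hs.2) hnull'.1
    rw [StieltjesFunction.measure_Ioc, ENNReal.ofReal_eq_zero, hF, hF, max_eq_left hb0,
      max_eq_left ht] at this
    linarith

/-- The Skorokhod regulator grows only where the reflected path vanishes. -/
theorem complementarity_of_eq_Psi {Y V K : ℝ → ℝ}
    (hY : ∀ t, 0 ≤ t → BddBelow (Y '' Set.Icc 0 t))
    (hVc : ∀ t : ℝ, 0 ≤ t → ContinuousWithinAt V (Set.Ici t) t)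
    (hKc : ∀ t : ℝ, 0 ≤ t → ContinuousWithinAt K (Set.Ici t) t)
    (hKmono : MonotoneOn K (Set.Ici 0))
    (hV : ∀ t, 0 ≤ t → V t = Y t + K t) (hK : ∀ t, 0 ≤ t → K t = Psi Y t) :
    lsMeasure K {t : ℝ | 0 ≤ t ∧ 0 < V t} = 0 := by
  obtain ⟨F, hF, hm⟩ := lsMeasureAux_eq hKmono hKc
  refine measure_eq_zero_of_forall_exists_Ico _ _ ?_
  rintro s ⟨hs, hVs⟩
  have hle : ∀ {t c : ℝ}, 0 ≤ t → (K t ≤ c ↔ 0 ≤ c ∧ ∀ u ∈ Set.Icc 0 t, -Y u ≤ c) := by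
    intro t c ht
    rw [hK t ht]
    exact Psi_le_iff ht (hY t ht)
  have hKs := (hle hs).1 le_rfl
  have hYs : -Y s < K s := by linarith [hV s hs]
  have hev : ∀ᶠ u in nhdsWithin s (Set.Ici s), 0 < V u - K u + K s :=
    (((hVc s hs).sub (hKc s hs)).add continuousWithinAt_const).eventually_const_lt
      (by simpa using hVs)
  obtain ⟨q, hq, hqs⟩ := (mem_nhdsGE_iff_exists_Icc_subset).1 hev
  have hsq : s < q := hq
  have hKq : K q ≤ K s := by
    refine (hle (hs.trans hsq.le)).2 ⟨hKs.1, fun u hu => ?_⟩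
    rcases le_total u s with h | h
    · exact hKs.2 u ⟨hu.1, h⟩
    · have h1 : 0 < V u - K u + K s := hqs ⟨h, hu.2⟩
      have h2 := hV u hu.1
      linarith
  have hleft : K s ≤ leftLim F s ∧ (s = 0 → K s = 0) := by
    rcases hs.eq_or_lt with h0 | h0
    · subst h0
      constructor
      · have := F.mono.le_leftLim (show (-1 : ℝ) < 0 by norm_num)
        rw [hF] at this
        simpa using this
      · intro _
        refine le_antisymm ?_ hKs.1
        have : K 0 ≤ max 0 (-Y 0) := (hle le_rfl).2 ⟨le_max_left _ _, fun u hu => by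
          rw [le_antisymm hu.2 hu.1]; exact le_max_right _ _⟩
        exact (le_max_iff.1 this).resolve_right (not_le.2 hYs)
    · refine ⟨?_, fun h => absurd h h0.ne'⟩
      have hu : ∀ u, 0 ≤ u → u < s → 0 ≤ leftLim F s ∧ -Y u ≤ leftLim F s := by
        intro u hu hus
        have h1 := F.mono.le_leftLim hus
        rw [hF, max_eq_left hu, hle hu] at h1
        exact ⟨h1.1, h1.2 u ⟨hu, le_rfl⟩⟩
      have : K s ≤ max (leftLim F s) (-Y s) := (hle hs).2
        ⟨(hu 0 le_rfl h0).1.trans (le_max_left _ _), fun u hus => by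
          rcases hus.2.eq_or_lt with h | h
          · rw [h]; exact le_max_right _ _
          · exact (hu u hus.1 h).2.trans (le_max_left _ _)⟩
      exact (le_max_iff.1 this).resolve_right (not_le.2 hYs)
  refine ⟨q, hsq, ?_⟩
  rw [lsMeasure, Measure.add_apply, add_eq_zero, hm]
  constructor
  · refine measure_mono_null Set.Ico_subset_Icc_self ?_
    rw [StieltjesFunction.measure_Icc, ENNReal.ofReal_eq_zero, hF, max_eq_left (hs.trans hsq.le)]
    linarith [hleft.1]
  · rcases hs.eq_or_lt with h0 | h0
    · have : K 0 = 0 := by simpa [← h0] using hleft.2 h0.symm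
      simp [this]
    · simp [h0]

/-- **Characterisation of the tax-reflection pair with constant tax rate and initial
maximum level 0 via the reflection map.** -/
theorem tax_reflection_pair_iff_reflection
    (γ : ℝ) (hγ : γ ∈ Set.Ico (0:ℝ) 1)
    (X : ℝ → ℝ) (hX : Cadlag X) (hXjumps : NoPosJumps X) (hX0 : X 0 ≤ 0)
    (V K : ℝ → ℝ) (hV : Cadlag V) (hK : Cadlag K)
    (hVpos : ∀ t : ℝ, 0 ≤ t → 0 ≤ V t)
    (hKmono : MonotoneOn K (Set.Ici 0)) :
    IsTaxReflectionPair (fun _ => γ) X 0 V K ↔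
      ∀ t : ℝ, 0 ≤ t →
        K t = Psi (fun s => X s - γ * runSup 0 (fun u => X u + K u) s) t ∧
        V t = Phi (fun s => X s - γ * runSup 0 (fun u => X u + K u) s) t := by
  obtain ⟨hγ0, hγ1⟩ := hγ
  have hZ : Cadlag (fun u => X u + K u) := hX.add hK
  have hS0 := runSup_zero 0 (fun u => X u + K u)
  have hSmono := runSup_monotoneOn hZ 0
  have hint : ∀ t : ℝ, 0 ≤ t →
      ∫ _s in Set.Ioc (0:ℝ) t, γ ∂(lsMeasure (runSup 0 (fun s => X s + K s))) =
        γ * (runSup 0 (fun u => X u + K u) t - runSup 0 (fun u => X u + K u) 0) := by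
    intro t ht
    rw [setIntegral_const, Measure.real,
      lsMeasure_Ioc hSmono (runSup_rightContinuous hZ 0) ht,
      ENNReal.toReal_ofReal (sub_nonneg.2 (hSmono self_mem_Ici ht ht)), smul_eq_mul, mul_comm]
  set S := runSup 0 (fun u => X u + K u)
  have hY : ∀ t, 0 ≤ t → BddBelow ((fun s => X s - γ * S s) '' Set.Icc 0 t) := by
    intro t ht
    obtain ⟨c, hc⟩ := (hX.isBounded_image t).bddBelow
    refine ⟨c - γ * S t, Set.forall_mem_image.2 fun u hu => ?_⟩
    exact sub_le_sub (hc (Set.mem_image_of_mem X hu))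
      (mul_le_mul_of_nonneg_left (hSmono hu.1 ht hu.2) hγ0)
  constructor
  · rintro ⟨-, -, -, -, hVeq, hnull⟩
    have hV0 : V 0 = X 0 + K 0 := by simpa using hVeq 0 le_rfl
    have hV0' := hVpos 0 le_rfl
    have hK0 : 0 ≤ K 0 := by linarith
    have hVz : V 0 = 0 := by
      by_contra hne
      have hp : 0 < V 0 := lt_of_le_of_ne hV0' (Ne.symm hne)
      have h := measure_mono_null
        (Set.singleton_subset_iff.2 (show (0 : ℝ) ∈ {t : ℝ | 0 ≤ t ∧ 0 < V t} from ⟨le_rfl, hp⟩))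
        hnull
      rw [lsMeasure, Measure.add_apply, add_eq_zero] at h
      have h2 : K 0 ≤ 0 := by simpa using h.2
      linarith
    have hSz : S 0 = 0 := by rw [hS0, ← hV0, hVz, max_self]
    have hVY : ∀ t, 0 ≤ t → V t = (X t - γ * S t) + K t := by
      intro t ht
      rw [hVeq t ht, hint t ht, hSz]
      ring
    intro t ht
    have hKt := eq_Psi_of_complementarity hY hK.1 hKmono hK0 hVpos hVY hnull ht
    exact ⟨hKt, by rw [Phi, ← hKt]; exact hVY t ht⟩
  · intro h
    have hVY : ∀ t, 0 ≤ t → V t = (X t - γ * S t) + K t := by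
      intro t ht
      rw [(h t ht).2, Phi, ← (h t ht).1]
    have hSz : S 0 = 0 := by
      rw [hS0]
      refine max_eq_left ?_
      by_contra! hp
      have hK0 : K 0 = max 0 (-(X 0 - γ * (X 0 + K 0))) := by
        have := (h 0 le_rfl).1
        rw [Psi] at this
        simpa [hS0, max_eq_right hp.le] using this
      rcases le_total 0 (-(X 0 - γ * (X 0 + K 0))) with h0 | h0
      · rw [max_eq_right h0] at hK0
        nlinarith
      · rw [max_eq_left h0] at hK0
        linarith
    refine ⟨hV, hK, hVpos, hKmono, fun t ht => ?_,
      complementarity_of_eq_Psi hY hV.1 hK.1 hKmono hVY fun t ht => (h t ht).1⟩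
    rw [hVY t ht, hint t ht, hSz]
    ring

end
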